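/- arXiv:2410.07272 — 3 statements merged into one kernel-verified Lean document; each statement's English description precedes it below -/
import Mathlib

section
/- Let 0 ≤ β < 1, γ, λ > 0, and let A^{t−1}, B^t ∈ ℝ^d be vectors. Suppose A^t = β A^{t−1} − (γ/λ) B^t. Then ‖A^{t−1}‖² ≤ (‖A^{t−1}‖² − ‖A^t‖²)/(1 − β) + (1/(1 − β)²)(γ²/λ²) ‖B^t‖². -/
/-- For `0 ≤ β < 1`, `γ, λ > 0` and vectors `A^{t-1}, B^t` with
`A^t = β A^{t-1} - (γ/λ) B^t`, we have
`‖A^{t-1}‖² ≤ (‖A^{t-1}‖² - ‖A^t‖²)/(1-β) + (1/(1-β)²)(γ²/λ²)‖B^t‖²`. -/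
theorem bounded_average_update
    (d : ℕ) (β γ lam : ℝ) (hβ0 : 0 ≤ β) (hβ1 : β < 1)
    (hγ : 0 < γ) (hlam : 0 < lam)
    (Aprev A B : EuclideanSpace ℝ (Fin d))
    (hA : A = β • Aprev - (γ / lam) • B) :
    ‖Aprev‖ ^ 2 ≤ (‖Aprev‖ ^ 2 - ‖A‖ ^ 2) / (1 - β) +
      (1 / (1 - β) ^ 2) * (γ ^ 2 / lam ^ 2) * ‖B‖ ^ 2 := by
  have h1β : 0 < 1 - β := sub_pos.mpr hβ1
  have hnorm : ‖A‖ ≤ β * ‖Aprev‖ + (1 - β) * (γ / lam * ‖B‖ / (1 - β)) := by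
    rw [mul_div_cancel₀ _ h1β.ne', hA]
    refine (norm_sub_le _ _).trans_eq ?_
    rw [norm_smul, norm_smul, Real.norm_of_nonneg hβ0, Real.norm_of_nonneg (by positivity)]
  have hsq : ‖A‖ ^ 2 ≤ β * ‖Aprev‖ ^ 2 + (1 - β) * (γ / lam * ‖B‖ / (1 - β)) ^ 2 :=
    (pow_le_pow_left₀ (norm_nonneg _) hnorm 2).trans <|
      (even_two.convexOn_pow (𝕜 := ℝ)).2 (Set.mem_univ _) (Set.mem_univ _) hβ0 h1β.le
        (add_sub_cancel β 1)
  have hdiv : ‖Aprev‖ ^ 2 - (γ / lam * ‖B‖ / (1 - β)) ^ 2 ≤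
      (‖Aprev‖ ^ 2 - ‖A‖ ^ 2) / (1 - β) := by
    rw [le_div_iff₀ h1β]
    linarith
  have hB : (γ / lam * ‖B‖ / (1 - β)) ^ 2 =
      (1 / (1 - β) ^ 2) * (γ ^ 2 / lam ^ 2) * ‖B‖ ^ 2 := by
    field_simp
  linarith
end

section
/- Let 0 ≤ β < 1, γ, λ > 0, and let x̄^{t−1}, x̄^t, B^t ∈ ℝ^d. Set A^{t−1} = x̄^t − x̄^{t−1}, A^t = β A^{t−1} − (γ/λ) B^t, and z^t = x̄^t + (β/(1 − β))(x̄^t − x̄^{t−1}). Then ‖z^t − x̄^t‖² = (β/(1 − β))² ‖A^{t−1}‖² ≤ β²(‖A^{t−1}‖² − ‖A^t‖²)/(1 − β)³ + (β²/(1 − β)⁴)(γ²/λ²) ‖B^t‖². -/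
/-- Convexity of the squared norm: `‖β a - b‖² ≤ β ‖a‖² + ‖b‖² / (1 - β)`, cleared of denominators. -/
theorem one_sub_mul_norm_smul_sub_sq_le {E : Type*} [SeminormedAddCommGroup E] [NormedSpace ℝ E]
    {β : ℝ} (hβ0 : 0 ≤ β) (hβ1 : β ≤ 1) (a b : E) :
    (1 - β) * ‖β • a - b‖ ^ 2 ≤ (1 - β) * β * ‖a‖ ^ 2 + ‖b‖ ^ 2 := by
  have htri : ‖β • a - b‖ ≤ β * ‖a‖ + ‖b‖ := by
    simpa [norm_smul, abs_of_nonneg hβ0] using norm_sub_le (β • a) b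
  calc (1 - β) * ‖β • a - b‖ ^ 2 ≤ (1 - β) * (β * ‖a‖ + ‖b‖) ^ 2 := by
        have : 0 ≤ 1 - β := sub_nonneg.2 hβ1
        gcongr
    _ ≤ (1 - β) * β * ‖a‖ ^ 2 + ‖b‖ ^ 2 := by
        linear_combination mul_nonneg hβ0 (sq_nonneg ((1 - β) * ‖a‖ - ‖b‖))

/-- With `0 ≤ β < 1`, `γ, λ > 0`, `A^{t-1} = x̄^t - x̄^{t-1}`,
`A^t = β A^{t-1} - (γ/λ) B^t` and `z^t = x̄^t + (β/(1-β))(x̄^t - x̄^{t-1})`, we have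
`‖z^t - x̄^t‖² = (β/(1-β))² ‖A^{t-1}‖²
  ≤ β²(‖A^{t-1}‖² - ‖A^t‖²)/(1-β)³ + (β²/(1-β)⁴)(γ²/λ²)‖B^t‖²`. -/
theorem bounded_error
    (d : ℕ) (β γ lam : ℝ) (hβ0 : 0 ≤ β) (hβ1 : β < 1)
    (hγ : 0 < γ) (hlam : 0 < lam)
    (xprev xcur B Aprev A z : EuclideanSpace ℝ (Fin d))
    (hAprev : Aprev = xcur - xprev)
    (hA : A = β • Aprev - (γ / lam) • B)
    (hz : z = xcur + (β / (1 - β)) • (xcur - xprev)) :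
    ‖z - xcur‖ ^ 2 = (β / (1 - β)) ^ 2 * ‖Aprev‖ ^ 2 ∧
    ‖z - xcur‖ ^ 2 ≤ β ^ 2 * (‖Aprev‖ ^ 2 - ‖A‖ ^ 2) / (1 - β) ^ 3 +
      (β ^ 2 / (1 - β) ^ 4) * (γ ^ 2 / lam ^ 2) * ‖B‖ ^ 2 := by
  have hpos : 0 < 1 - β := sub_pos.2 hβ1
  have heq : ‖z - xcur‖ ^ 2 = (β / (1 - β)) ^ 2 * ‖Aprev‖ ^ 2 := by
    rw [hz, add_sub_cancel_left, ← hAprev, norm_smul, mul_pow, Real.norm_eq_abs, sq_abs]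
  refine ⟨heq, ?_⟩
  have hstep := one_sub_mul_norm_smul_sub_sq_le hβ0 hβ1.le Aprev ((γ / lam) • B)
  rw [← hA, norm_smul, mul_pow, Real.norm_eq_abs, sq_abs, div_pow] at hstep
  rw [heq, ← sub_nonneg]
  have hrw : β ^ 2 * (‖Aprev‖ ^ 2 - ‖A‖ ^ 2) / (1 - β) ^ 3 +
      (β ^ 2 / (1 - β) ^ 4) * (γ ^ 2 / lam ^ 2) * ‖B‖ ^ 2 - (β / (1 - β)) ^ 2 * ‖Aprev‖ ^ 2 =
      β ^ 2 / (1 - β) ^ 4 * ((1 - β) * β * ‖Aprev‖ ^ 2 + γ ^ 2 / lam ^ 2 * ‖B‖ ^ 2 -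
        (1 - β) * ‖A‖ ^ 2) := by
    field_simp
    ring
  rw [hrw]
  exact mul_nonneg (by positivity) (sub_nonneg.2 hstep)
end

section
/- Let 0 < λ < 1 and 0 < α < 1. Then for every integer t ≥ 1, ∑_{s=0}^{t−1} λ^{t−s−1}/(s+1)^α ≤ κ_ψ / t^α, where κ_ψ = (α/e)^α · 1/(λ (ln(1/λ))^α) + 2^α/((1−α)·e·λ·ln(1/λ)) + 2^α/(λ·ln(1/λ)). -/
theorem sum_range_inv_rpow_le {α : ℝ} (hα0 : 0 < α) (hα1 : α < 1) (m : ℕ) :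
    ∑ s ∈ Finset.range m, 1 / ((s : ℝ) + 1) ^ α ≤ (m : ℝ) ^ (1 - α) / (1 - α) := by
  have hα : 0 < 1 - α := by linarith
  induction m with
  | zero => simp [Real.zero_rpow hα.ne']
  | succ m ih =>
    rw [Finset.sum_range_succ]
    have hm : (0 : ℝ) < (m : ℝ) + 1 := by positivity
    have hm1 : 1 / ((m : ℝ) + 1) ≤ 1 := by
      rw [div_le_one hm]
      have : (0 : ℝ) ≤ m := by positivity
      linarith
    have bernoulli : (1 + -(1 / ((m : ℝ) + 1))) ^ (1 - α) ≤
        1 + (1 - α) * -(1 / ((m : ℝ) + 1)) :=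
      rpow_one_add_le_one_add_mul_self (by linarith) hα.le (by linarith)
    have hfac : (m : ℝ) ^ (1 - α) =
        ((m : ℝ) + 1) ^ (1 - α) * (1 + -(1 / ((m : ℝ) + 1))) ^ (1 - α) := by
      rw [← Real.mul_rpow hm.le (by linarith)]
      congr 1
      field_simp
      ring
    have hpow : ((m : ℝ) + 1) ^ (1 - α) = ((m : ℝ) + 1) / ((m : ℝ) + 1) ^ α := by
      rw [Real.rpow_sub hm, Real.rpow_one]
    have step : (m : ℝ) ^ (1 - α) ≤
        ((m : ℝ) + 1) ^ (1 - α) - (1 - α) * (1 / ((m : ℝ) + 1) ^ α) := by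
      calc (m : ℝ) ^ (1 - α)
          ≤ ((m : ℝ) + 1) ^ (1 - α) * (1 + (1 - α) * -(1 / ((m : ℝ) + 1))) := by
            rw [hfac]; gcongr
        _ = _ := by rw [hpow]; field_simp; ring
    push_cast
    rw [le_div_iff₀ hα] at ih ⊢
    linarith

theorem sum_range_pow_sub_le {r : ℝ} (hr0 : 0 < r) (hr1 : r < 1) (n : ℕ) :
    ∑ i ∈ Finset.range n, r ^ (n - 1 - i) ≤ 1 / (r * Real.log (1 / r)) := by
  have hc : 0 < Real.log (1 / r) := Real.log_pos (by rwa [lt_div_iff₀ hr0, one_mul])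
  have hlog : Real.log (1 / r) ≤ 1 / r - 1 := Real.log_le_sub_one_of_pos (by positivity)
  have hle : r * Real.log (1 / r) ≤ 1 - r := by
    calc r * Real.log (1 / r) ≤ r * (1 / r - 1) := by gcongr
      _ = 1 - r := by field_simp
  rw [Finset.sum_range_reflect (fun i => r ^ i) n]
  have hr : 0 < 1 - r := by linarith
  calc ∑ i ∈ Finset.range n, r ^ i = (1 - r ^ n) / (1 - r) := by
        rw [eq_div_iff hr.ne', geom_sum_mul_neg]
    _ ≤ 1 / (1 - r) := by
        gcongr
        linarith [pow_pos hr0 n]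
    _ ≤ _ := by gcongr

/-- For `0 < λ < 1` and `0 < α < 1`, for every integer `t ≥ 1`,
`∑_{s=0}^{t-1} λ^{t-s-1}/(s+1)^α ≤ κ_ψ / t^α` with
`κ_ψ = (α/e)^α / (λ (ln(1/λ))^α) + 2^α/((1-α) e λ ln(1/λ)) + 2^α/(λ ln(1/λ))`. -/
theorem discounted_polynomial_sum_bound
    (lam α : ℝ) (hlam0 : 0 < lam) (hlam1 : lam < 1)
    (hα0 : 0 < α) (hα1 : α < 1) (t : ℕ) (ht : 1 ≤ t) :
    ∑ s ∈ Finset.range t, lam ^ (t - s - 1) / ((s : ℝ) + 1) ^ α ≤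
      ((α / Real.exp 1) ^ α * (1 / (lam * (Real.log (1 / lam)) ^ α)) +
        2 ^ α / ((1 - α) * Real.exp 1 * lam * Real.log (1 / lam)) +
        2 ^ α / (lam * Real.log (1 / lam))) / (t : ℝ) ^ α := by
  have hα : 0 < 1 - α := by linarith
  have hc : 0 < Real.log (1 / lam) := Real.log_pos (by rwa [lt_div_iff₀ hlam0, one_mul])
  have ht0 : (0 : ℝ) < t := by exact_mod_cast ht
  obtain ⟨m, n, hmn, hle, hge⟩ : ∃ m n : ℕ, t = m + n ∧ m ≤ n ∧ n ≤ m + 1 :=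
    ⟨t / 2, t - t / 2, by omega, by omega, by omega⟩
  have hmnR : (t : ℝ) = m + n := by exact_mod_cast hmn
  have hleR : (m : ℝ) ≤ n := by exact_mod_cast hle
  have hgeR : (n : ℝ) ≤ m + 1 := by exact_mod_cast hge
  set x : ℝ := t / 2 with hx
  have hx0 : 0 < x := by positivity
  have hxα : 1 / x ^ α = 2 ^ α / (t : ℝ) ^ α := by
    rw [hx, Real.div_rpow ht0.le (by norm_num), one_div_div]
  have hexp : lam ^ n ≤ 1 / (Real.exp 1 * Real.log (1 / lam) * x) := by
    set c := Real.log (1 / lam) with hcdef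
    have hlam : lam = Real.exp (-c) := by
      rw [hcdef, one_div, Real.log_inv, neg_neg, Real.exp_log hlam0]
    have h1 : c * x ≤ Real.exp (c * x - 1) := by
      have := Real.add_one_le_exp (c * x - 1)
      linarith
    calc lam ^ n = Real.exp (-(c * n)) := by
          rw [hlam, ← Real.exp_nat_mul]; congr 1; ring
      _ ≤ Real.exp (-(c * x)) := by
          gcongr
          linarith
      _ = 1 / (Real.exp 1 * Real.exp (c * x - 1)) := by
          rw [← Real.exp_add, one_div, ← Real.exp_neg]; congr 1; ring
      _ ≤ 1 / (Real.exp 1 * (c * x)) := by gcongr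
      _ = _ := by rw [mul_assoc]
  have head : ∑ s ∈ Finset.range m, lam ^ (t - s - 1) / ((s : ℝ) + 1) ^ α ≤
      2 ^ α / ((1 - α) * Real.exp 1 * lam * Real.log (1 / lam)) / (t : ℝ) ^ α := by
    calc ∑ s ∈ Finset.range m, lam ^ (t - s - 1) / ((s : ℝ) + 1) ^ α
        ≤ ∑ s ∈ Finset.range m, lam ^ n * (1 / ((s : ℝ) + 1) ^ α) := by
          refine Finset.sum_le_sum fun s hs => ?_
          have hs := Finset.mem_range.mp hs
          rw [mul_one_div]
          have : lam ^ (t - s - 1) ≤ lam ^ n :=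
            pow_le_pow_of_le_one hlam0.le hlam1.le (by omega)
          gcongr
      _ = lam ^ n * ∑ s ∈ Finset.range m, 1 / ((s : ℝ) + 1) ^ α := by rw [Finset.mul_sum]
      _ ≤ 1 / (Real.exp 1 * Real.log (1 / lam) * x) * (x ^ (1 - α) / (1 - α)) := by
          have h1 := sum_range_inv_rpow_le hα0 hα1 m
          have h2 : (m : ℝ) ^ (1 - α) ≤ x ^ (1 - α) :=
            Real.rpow_le_rpow (by positivity) (by linarith) hα.le
          have h3 : (m : ℝ) ^ (1 - α) / (1 - α) ≤ x ^ (1 - α) / (1 - α) := by gcongr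
          have h4 := h1.trans h3
          gcongr
      _ = 1 / ((1 - α) * Real.exp 1 * 1 * Real.log (1 / lam)) * (1 / x ^ α) := by
          rw [Real.rpow_sub hx0, Real.rpow_one]; field_simp
      _ ≤ 1 / ((1 - α) * Real.exp 1 * lam * Real.log (1 / lam)) * (1 / x ^ α) := by
          gcongr
      _ = _ := by rw [hxα]; ring
  have tail : ∑ i ∈ Finset.range n, lam ^ (t - (m + i) - 1) / (((m + i : ℕ) : ℝ) + 1) ^ α ≤
      2 ^ α / (lam * Real.log (1 / lam)) / (t : ℝ) ^ α := by
    calc ∑ i ∈ Finset.range n, lam ^ (t - (m + i) - 1) / (((m + i : ℕ) : ℝ) + 1) ^ α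
        ≤ ∑ i ∈ Finset.range n, lam ^ (n - 1 - i) * (1 / x ^ α) := by
          refine Finset.sum_le_sum fun i _ => ?_
          rw [mul_one_div, show t - (m + i) - 1 = n - 1 - i by omega]
          have : x ≤ ((m + i : ℕ) : ℝ) + 1 := by
            push_cast
            have : (0 : ℝ) ≤ i := by positivity
            linarith
          gcongr
      _ = (∑ i ∈ Finset.range n, lam ^ (n - 1 - i)) * (1 / x ^ α) := by rw [Finset.sum_mul]
      _ ≤ 1 / (lam * Real.log (1 / lam)) * (1 / x ^ α) := by
          have := sum_range_pow_sub_le hlam0 hlam1 n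
          gcongr
      _ = _ := by rw [hxα]; ring
  have first : 0 ≤ (α / Real.exp 1) ^ α * (1 / (lam * (Real.log (1 / lam)) ^ α)) /
      (t : ℝ) ^ α := by positivity
  have split : ∑ s ∈ Finset.range t, lam ^ (t - s - 1) / ((s : ℝ) + 1) ^ α =
      ∑ s ∈ Finset.range m, lam ^ (t - s - 1) / ((s : ℝ) + 1) ^ α +
      ∑ i ∈ Finset.range n, lam ^ (t - (m + i) - 1) / (((m + i : ℕ) : ℝ) + 1) ^ α := by
    rw [← Finset.sum_range_add (fun s : ℕ => lam ^ (t - s - 1) / ((s : ℝ) + 1) ^ α), ← hmn]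
  rw [split, add_div, add_div]
  linarith
end
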